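/- Let U₁, U₂ be unitary d×d complex matrices such that U₁* U₂ is not a scalar multiple of the identity (equivalently, the unitary channels 𝒰₁(X) = U₁ X U₁* and 𝒰₂(X) = U₂ X U₂* are different). Then for every α ∈ (0,1), the channel α-fidelity vanishes: 𝓕_α(𝒰₁, 𝒰₂) = 0. -/

import Mathlib

open Matrix
open scoped Kronecker ComplexOrder

/-- Real power of a (Hermitian) matrix, defined by applying the real power function to the
eigenvalues via the spectral decomposition (functional calculus). -/
noncomputable def mpow {ι : Type*} [Fintype ι] [DecidableEq ι]
    (A : Matrix ι ι ℂ) (t : ℝ) : Matrix ι ι ℂ :=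
  if hA : A.IsHermitian then
    (hA.eigenvectorUnitary : Matrix ι ι ℂ) *
      Matrix.diagonal (fun i => ((hA.eigenvalues i ^ t : ℝ) : ℂ)) *
      star (hA.eigenvectorUnitary : Matrix ι ι ℂ)
  else 0

/-- The α-fidelity `F_α(ρ,σ) = tr[(σ^((1−α)/(2α)) ρ σ^((1−α)/(2α)))^α]`. -/
noncomputable def aFid {ι : Type*} [Fintype ι] [DecidableEq ι]
    (α : ℝ) (ρ σ : Matrix ι ι ℂ) : ℝ :=
  (Matrix.trace (mpow (mpow σ ((1 - α) / (2 * α)) * ρ * mpow σ ((1 - α) / (2 * α))) α)).re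

/-- A density matrix: positive semidefinite with trace 1. -/
def IsDensity {ι : Type*} [Fintype ι] (ρ : Matrix ι ι ℂ) : Prop :=
  ρ.PosSemidef ∧ ρ.trace = 1

/-- Partial trace over the second tensor factor. -/
noncomputable def ptrace2 {ι κ : Type*} [Fintype κ]
    (M : Matrix (ι × κ) (ι × κ) ℂ) : Matrix ι ι ℂ :=
  Matrix.of fun i j => ∑ k : κ, M (i, k) (j, k)

/-- A quantum channel: a map admitting a Kraus representation `E(X) = Σ_i K_i X K_i*`
with `Σ_i K_i* K_i = 1`. -/
def IsQChannel {ι κ : Type*} [Fintype ι] [DecidableEq ι] [Fintype κ] [DecidableEq κ]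
    (E : Matrix ι ι ℂ → Matrix κ κ ℂ) : Prop :=
  ∃ (k : ℕ) (K : Fin k → Matrix κ ι ℂ),
    (∀ X, E X = ∑ i, K i * X * (K i)ᴴ) ∧ (∑ i, (K i)ᴴ * K i = 1)

/-- The α-fidelity of channels:
`𝓕_α(E₁,E₂) = inf { F_α(E₁(ρ₁),E₂(ρ₂)) / F_α(ρ₁,ρ₂) }` over density matrices with
`F_α(ρ₁,ρ₂) > 0`. -/
noncomputable def chanFid {ι κ : Type*} [Fintype ι] [DecidableEq ι] [Fintype κ] [DecidableEq κ]
    (α : ℝ) (E₁ E₂ : Matrix ι ι ℂ → Matrix κ κ ℂ) : ℝ :=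
  sInf { r : ℝ | ∃ ρ₁ ρ₂ : Matrix ι ι ℂ, IsDensity ρ₁ ∧ IsDensity ρ₂ ∧
    0 < aFid α ρ₁ ρ₂ ∧ r = aFid α (E₁ ρ₁) (E₂ ρ₂) / aFid α ρ₁ ρ₂ }

theorem mpow_isHermitian {ι : Type*} [Fintype ι] [DecidableEq ι] (A : Matrix ι ι ℂ) (t : ℝ) :
    (mpow A t).IsHermitian := by
  unfold mpow
  split_ifs with hA
  · rw [star_eq_conjTranspose]
    exact isHermitian_mul_mul_conjTranspose _
      (isHermitian_diagonal_of_self_adjoint _ (by ext i; simp))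
  · exact isHermitian_zero

theorem re_trace_mpow {ι : Type*} [Fintype ι] [DecidableEq ι] {A : Matrix ι ι ℂ}
    (hA : A.IsHermitian) (t : ℝ) :
    (mpow A t).trace.re = ∑ i, hA.eigenvalues i ^ t := by
  rw [mpow, dif_pos hA, trace_mul_comm, ← mul_assoc, Unitary.coe_star_mul_self, one_mul,
    trace_diagonal]
  simp

/-- A nonzero real power of an orthogonal projection is the projection itself. -/
theorem mpow_eq_self_of_idempotent {ι : Type*} [Fintype ι] [DecidableEq ι] {P : Matrix ι ι ℂ}
    (hP : P.IsHermitian) (hPP : P * P = P) {t : ℝ} (ht : t ≠ 0) : mpow P t = P := by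
  have heig (i : ι) : hP.eigenvalues i ^ t = hP.eigenvalues i := by
    have hmem : hP.eigenvalues i = 0 ∨ hP.eigenvalues i = 1 := by
      have hidem : IsIdempotentElem P := hPP
      have h := hidem.spectrum_subset ℝ (hP.eigenvalues_mem_spectrum_real i)
      simpa using h
    rcases hmem with h | h <;> simp [h, ht]
  rw [mpow, dif_pos hP]
  simp_rw [heig]
  exact hP.spectral_theorem.symm

theorem conj_mpow_posSemidef {ι : Type*} [Fintype ι] [DecidableEq ι] {ρ : Matrix ι ι ℂ}
    (hρ : ρ.PosSemidef) (σ : Matrix ι ι ℂ) (s : ℝ) :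
    (mpow σ s * ρ * mpow σ s).PosSemidef := by
  simpa only [(mpow_isHermitian σ s).eq] using hρ.mul_mul_conjTranspose_same (mpow σ s)

theorem aFid_nonneg {ι : Type*} [Fintype ι] [DecidableEq ι] (α : ℝ) {ρ : Matrix ι ι ℂ}
    (hρ : ρ.PosSemidef) (σ : Matrix ι ι ℂ) : 0 ≤ aFid α ρ σ := by
  have h := conj_mpow_posSemidef hρ σ ((1 - α) / (2 * α))
  rw [aFid, re_trace_mpow h.1]
  exact Finset.sum_nonneg fun i _ => Real.rpow_nonneg (h.eigenvalues_nonneg i) α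

theorem re_trace_mpow_pos {ι : Type*} [Fintype ι] [DecidableEq ι] {A : Matrix ι ι ℂ}
    (hA : A.PosSemidef) (hA0 : A ≠ 0) (t : ℝ) : 0 < (mpow A t).trace.re := by
  rw [re_trace_mpow hA.1]
  obtain ⟨i, hi⟩ : ∃ i, hA.1.eigenvalues i ≠ 0 := by
    by_contra! h
    exact hA0 (hA.1.eigenvalues_eq_zero_iff.mp (funext h))
  exact Finset.sum_pos' (fun i _ => Real.rpow_nonneg (hA.eigenvalues_nonneg i) t)
    ⟨i, Finset.mem_univ i, Real.rpow_pos_of_pos ((hA.eigenvalues_nonneg i).lt_of_ne' hi) t⟩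

theorem vecMulVec_star_mul_self {ι : Type*} [Fintype ι] {v : ι → ℂ} (hv : star v ⬝ᵥ v = 1) :
    vecMulVec v (star v) * vecMulVec v (star v) = vecMulVec v (star v) := by
  rw [vecMulVec_mul_vecMulVec, hv, one_smul]

theorem isDensity_vecMulVec_star {ι : Type*} [Fintype ι] {v : ι → ℂ} (hv : star v ⬝ᵥ v = 1) :
    IsDensity (vecMulVec v (star v)) :=
  ⟨posSemidef_vecMulVec_self_star v, by rw [trace_vecMulVec, dotProduct_comm, hv]⟩

theorem conj_vecMulVec_star {ι κ : Type*} [Fintype ι] (A : Matrix κ ι ℂ) (v : ι → ℂ) :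
    A * vecMulVec v (star v) * Aᴴ = vecMulVec (A *ᵥ v) (star (A *ᵥ v)) := by
  rw [mul_vecMulVec, vecMulVec_mul, star_mulVec]

theorem star_mulVec_dotProduct {ι κ : Type*} [Fintype ι] [Fintype κ] (A : Matrix κ ι ℂ)
    (v : ι → ℂ) (u : κ → ℂ) : star (A *ᵥ v) ⬝ᵥ u = star v ⬝ᵥ (Aᴴ *ᵥ u) := by
  rw [star_mulVec, dotProduct_mulVec]

/-- The compressed operator in the definition of `aFid`, for pure states. -/
theorem conj_mpow_pure {ι : Type*} [Fintype ι] [DecidableEq ι] {x z : ι → ℂ}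
    (hx : star x ⬝ᵥ x = 1) {s : ℝ} (hs : s ≠ 0) :
    mpow (vecMulVec x (star x)) s * vecMulVec z (star z) * mpow (vecMulVec x (star x)) s =
      vecMulVec ((star x ⬝ᵥ z) • x) (star ((star x ⬝ᵥ z) • x)) := by
  have hP : (vecMulVec x (star x)).IsHermitian := (posSemidef_vecMulVec_self_star x).1
  rw [mpow_eq_self_of_idempotent hP (vecMulVec_star_mul_self hx) hs]
  nth_rewrite 2 [← hP.eq]
  rw [conj_vecMulVec_star, vecMulVec_mulVec, op_smul_eq_smul]

theorem aFid_pure_eq_zero {ι : Type*} [Fintype ι] [DecidableEq ι] {x z : ι → ℂ}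
    (hx : star x ⬝ᵥ x = 1) (hxz : star x ⬝ᵥ z = 0) {α : ℝ} (hα : 0 < α) (hα' : α < 1) :
    aFid α (vecMulVec z (star z)) (vecMulVec x (star x)) = 0 := by
  have hs : (1 - α) / (2 * α) ≠ 0 := (div_pos (by linarith) (by linarith)).ne'
  rw [aFid, conj_mpow_pure hx hs, hxz, zero_smul, zero_vecMulVec,
    mpow_eq_self_of_idempotent isHermitian_zero (mul_zero 0) hα.ne']
  simp

theorem aFid_pure_pos {ι : Type*} [Fintype ι] [DecidableEq ι] {x z : ι → ℂ}
    (hx : star x ⬝ᵥ x = 1) (hxz : star x ⬝ᵥ z ≠ 0) {α : ℝ} (hα : 0 < α) (hα' : α < 1) :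
    0 < aFid α (vecMulVec z (star z)) (vecMulVec x (star x)) := by
  have hs : (1 - α) / (2 * α) ≠ 0 := (div_pos (by linarith) (by linarith)).ne'
  rw [aFid, conj_mpow_pure hx hs]
  refine re_trace_mpow_pos (posSemidef_vecMulVec_self_star _) (fun h => ?_) α
  have hx0 : x ≠ 0 := by
    rintro rfl
    simp at hx
  rw [vecMulVec_eq_zero, star_eq_zero, or_self, smul_eq_zero] at h
  exact h.elim hxz hx0

theorem exists_smul_normalized {ι : Type*} [Fintype ι] {v : ι → ℂ} (hv : v ≠ 0) :
    ∃ c : ℂ, c ≠ 0 ∧ star (c • v) ⬝ᵥ (c • v) = 1 := by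
  have hpos : 0 < star v ⬝ᵥ v := dotProduct_star_self_pos_iff.mpr hv
  obtain ⟨hre, him⟩ := Complex.pos_iff.mp hpos
  have hreal : star v ⬝ᵥ v = ((star v ⬝ᵥ v).re : ℂ) := Complex.ext rfl (by simp [← him])
  set r := (star v ⬝ᵥ v).re
  have hsq : (√r : ℂ) * √r = r := by rw [← Complex.ofReal_mul, Real.mul_self_sqrt hre.le]
  have hr : (√r : ℂ) ≠ 0 := by simpa using (Real.sqrt_pos.mpr hre).ne'
  refine ⟨(√r : ℂ)⁻¹, inv_ne_zero hr, ?_⟩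
  rw [star_smul, smul_dotProduct, dotProduct_smul, hreal, ← hsq]
  simp [hr]

/-- A matrix for which every vector is an eigenvector is scalar. -/
theorem exists_eq_smul_one_of_forall_mulVec {ι K : Type*} [Fintype ι] [DecidableEq ι] [Field K]
    {W : Matrix ι ι K} (hW : ∀ x : ι → K, ∃ c : K, W *ᵥ x = c • x) : ∃ c : K, W = c • 1 := by
  have hoff (i j : ι) (hij : i ≠ j) : W i j = 0 := by
    obtain ⟨c, hc⟩ := hW (Pi.single j 1)
    simpa [hij] using congrFun hc i
  obtain ⟨c, hc⟩ := hW 1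
  refine ⟨c, ?_⟩
  ext i j
  by_cases hij : i = j
  · subst hij
    have h : ∑ j, W i j = c := by simpa [mulVec, dotProduct] using congrFun hc i
    rw [Finset.sum_eq_single i (fun j _ hj => hoff i j hj.symm) (by simp)] at h
    simp [h]
  · simp [hij, hoff i j hij]


/-- the channel α-fidelity of two different unitary channels vanishes. -/
theorem stmt13 {d : ℕ} (U₁ U₂ : Matrix (Fin d) (Fin d) ℂ)
    (hU₁ : U₁ ∈ Matrix.unitaryGroup (Fin d) ℂ) (hU₂ : U₂ ∈ Matrix.unitaryGroup (Fin d) ℂ)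
    (hscalar : ∀ c : ℂ, U₁ᴴ * U₂ ≠ c • (1 : Matrix (Fin d) (Fin d) ℂ))
    (α : ℝ) (hα : 0 < α) (hα' : α < 1) :
    chanFid α (fun X => U₁ * X * U₁ᴴ) (fun X => U₂ * X * U₂ᴴ) = 0 := by
  set S := { r : ℝ | ∃ ρ₁ ρ₂ : Matrix (Fin d) (Fin d) ℂ, IsDensity ρ₁ ∧ IsDensity ρ₂ ∧
    0 < aFid α ρ₁ ρ₂ ∧ r = aFid α (U₁ * ρ₁ * U₁ᴴ) (U₂ * ρ₂ * U₂ᴴ) / aFid α ρ₁ ρ₂ }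
  change sInf S = 0
  suffices h0 : (0 : ℝ) ∈ S by
    refine IsLeast.csInf_eq ⟨h0, ?_⟩
    rintro r ⟨ρ₁, ρ₂, h₁, -, hpos, rfl⟩
    exact div_nonneg (aFid_nonneg α (h₁.1.mul_mul_conjTranspose_same U₁) _) hpos.le
  have hU₁' : U₁ * U₁ᴴ = 1 := mem_unitaryGroup_iff.mp hU₁
  have hU₂' : U₂ᴴ * U₂ = 1 := mem_unitaryGroup_iff'.mp hU₂
  obtain ⟨x₀, hx₀⟩ : ∃ x : Fin d → ℂ, ∀ c : ℂ, (U₁ᴴ * U₂) *ᵥ x ≠ c • x := by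
    by_contra! h
    obtain ⟨c, hc⟩ := exists_eq_smul_one_of_forall_mulVec h
    exact hscalar c hc
  have hx₀0 : x₀ ≠ 0 := by
    rintro rfl
    exact hx₀ 0 (by simp)
  obtain ⟨a, ha, hx⟩ := exists_smul_normalized hx₀0
  set x := a • x₀ with hxdef
  set w := (U₁ᴴ * U₂) *ᵥ x with hwdef
  have hxw (c : ℂ) : w ≠ c • x := by
    intro h
    rw [hwdef, hxdef, mulVec_smul, smul_comm c a] at h
    exact hx₀ c (smul_right_injective _ ha h)
  have hy : star (U₂ *ᵥ x) ⬝ᵥ (U₂ *ᵥ x) = 1 := by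
    rw [star_mulVec_dotProduct, mulVec_mulVec, hU₂', one_mulVec, hx]
  have hw : star w ⬝ᵥ w = 1 := by
    rw [hwdef, ← mulVec_mulVec, star_mulVec_dotProduct, mulVec_mulVec, conjTranspose_conjTranspose,
      hU₁', one_mulVec, hy]
  set z₀ := x - (star w ⬝ᵥ x) • w with hz₀
  have hwz₀ : star w ⬝ᵥ z₀ = 0 := by
    rw [hz₀, dotProduct_sub, dotProduct_smul (star w ⬝ᵥ x), hw, smul_eq_mul, mul_one, sub_self]
  have hz₀0 : z₀ ≠ 0 := by
    intro h
    have hxeq : x = (star w ⬝ᵥ x) • w := sub_eq_zero.mp h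
    have hb : star w ⬝ᵥ x ≠ 0 := by
      intro hb
      rw [hb, zero_smul] at hxeq
      simp [hxeq] at hx
    refine hxw (star w ⬝ᵥ x)⁻¹ ?_
    rw [eq_inv_smul_iff₀ hb]
    exact hxeq.symm
  have hxz₀ : star x ⬝ᵥ z₀ ≠ 0 := by
    have hxz : x = z₀ + (star w ⬝ᵥ x) • w := by rw [hz₀, sub_add_cancel]
    have h : star x ⬝ᵥ z₀ = star z₀ ⬝ᵥ z₀ := by
      conv_lhs => rw [hxz]
      rw [star_add, star_smul, add_dotProduct, smul_dotProduct, hwz₀, smul_zero, add_zero]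
    rw [h]
    exact (dotProduct_star_self_pos_iff.mpr hz₀0).ne'
  obtain ⟨b, hb, hz⟩ := exists_smul_normalized hz₀0
  have hxz : star x ⬝ᵥ (b • z₀) ≠ 0 := by
    rw [dotProduct_smul]
    exact smul_ne_zero hb hxz₀
  refine ⟨vecMulVec (b • z₀) (star (b • z₀)), vecMulVec x (star x), isDensity_vecMulVec_star hz,
    isDensity_vecMulVec_star hx, aFid_pure_pos hx hxz hα hα', ?_⟩
  have horth : star (U₂ *ᵥ x) ⬝ᵥ (U₁ *ᵥ (b • z₀)) = 0 := by
    have h : star w ⬝ᵥ (b • z₀) = 0 := by rw [dotProduct_smul, hwz₀, smul_zero]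
    rwa [hwdef, ← mulVec_mulVec, star_mulVec_dotProduct, conjTranspose_conjTranspose] at h
  rw [conj_vecMulVec_star, conj_vecMulVec_star, aFid_pure_eq_zero hy horth hα hα', zero_div]
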